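/- Fix k ≥ 1 and two distinct configurations c and c' of multisets of positive integers summing to k, with sizes l and l' respectively, and for each N > k let P_N(c,c') = Σ_{y : {y} = c'} Q(x,y) for any x ∈ I^k with {x} = c (this value does not depend on the choice of x). Then: if l' = l + 1, P_N(c,c') = O(1/N) as N → ∞; and if l' ≤ l, P_N(c,c') = O(1/N²) as N → ∞. -/

import Mathlib

open Finset

/-- The finite set of triples (father, mother, child) of pairwise distinct individuals. -/
def distinctTriplesFinset (N : ℕ) : Finset (Fin N × Fin N × Fin N) :=
  Finset.univ.filter fun p => p.1 ≠ p.2.1 ∧ p.1 ≠ p.2.2 ∧ p.2.1 ≠ p.2.2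

/-- The factor `q_m(x, y, π, μ, κ)`: equals `1_{y_m = x_m}` if `x_m ≠ κ`, and
`(1/2)·1_{y_m = π} + (1/2)·1_{y_m = μ}` if `x_m = κ`. -/
noncomputable def qFactor {N k : ℕ} (x y : Fin k → Fin N)
    (p : Fin N × Fin N × Fin N) (m : Fin k) : ℝ :=
  if x m = p.2.2 then
    (if y m = p.1 then 1 / 2 else 0) + (if y m = p.2.1 then 1 / 2 else 0)
  else if y m = x m then 1 else 0

/-- The transition matrix `Q` of the annealed `k`-particle Moran chain on `I^k`. -/
noncomputable def Qmat (N k : ℕ) : Matrix (Fin k → Fin N) (Fin k → Fin N) ℝ :=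
  fun x y =>
    (1 / ((N : ℝ) * ((N : ℝ) - 1) * ((N : ℝ) - 2))) *
      ∑ p ∈ distinctTriplesFinset N, ∏ m : Fin k, qFactor x y p m

/-- The configuration `{x}` of `x ∈ I^k`: the multiset of multiplicities with which the
distinct values of `I` appear among the coordinates of `x`. Its size (number of elements,
i.e. number of distinct values) is `(config x).card`. -/
def config {N k : ℕ} (x : Fin k → Fin N) : Multiset ℕ :=
  (Finset.image x Finset.univ).val.map fun v => (Finset.univ.filter fun m => x m = v).card


lemma aux_config_card {N k : ℕ} (x : Fin k → Fin N) :
    (config x).card = (Finset.image x Finset.univ).card := by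
  rw [config, Multiset.card_map, Finset.card_val]

lemma aux_config_comp {N k : ℕ} (x : Fin k → Fin N) (e : Equiv.Perm (Fin N)) :
    config (fun m => e (x m)) = config x := by
  unfold config
  have h : Finset.image (fun m => e (x m)) Finset.univ
      = (Finset.image x Finset.univ).map e.toEmbedding := by
    ext v; simp [Finset.mem_image, Equiv.eq_symm_apply]
  rw [h, Finset.map_val, Multiset.map_map]
  apply Multiset.map_congr rfl
  intro v _
  simp

lemma aux_q_nonneg {N k : ℕ} (x y : Fin k → Fin N) (p : Fin N × Fin N × Fin N) (m : Fin k) :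
    0 ≤ qFactor x y p m := by
  unfold qFactor
  split_ifs <;> norm_num

lemma aux_q_ne {N k : ℕ} {x y : Fin k → Fin N} {p : Fin N × Fin N × Fin N}
    (h : ∏ m : Fin k, qFactor x y p m ≠ 0) (m : Fin k) :
    (x m ≠ p.2.2 → y m = x m) ∧ (x m = p.2.2 → y m = p.1 ∨ y m = p.2.1) := by
  have hm := (Finset.prod_ne_zero_iff.mp h) m (Finset.mem_univ m)
  unfold qFactor at hm
  constructor
  · intro h1
    rw [if_neg h1] at hm
    by_contra h2
    simp [h2] at hm
  · intro h1
    rw [if_pos h1] at hm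
    by_contra! h2
    simp [h2.1, h2.2] at hm

lemma aux_sum_one {N k : ℕ} (x : Fin k → Fin N) (p : Fin N × Fin N × Fin N) :
    ∑ y : Fin k → Fin N, ∏ m : Fin k, qFactor x y p m = 1 := by
  have h := Finset.prod_univ_sum (fun _ : Fin k => (Finset.univ : Finset (Fin N)))
    (fun m v => if x m = p.2.2 then
      ((if v = p.1 then 1 / 2 else 0) + (if v = p.2.1 then 1 / 2 else 0) : ℝ)
      else if v = x m then 1 else 0)
  rw [Fintype.piFinset_univ] at h
  unfold qFactor
  rw [← h]
  apply Finset.prod_eq_one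
  intro m _
  by_cases hx : x m = p.2.2
  · simp only [hx, if_true, Finset.sum_add_distrib]
    simp
    norm_num
  · simp [hx]

lemma aux_bound {N k : ℕ} (hN : 3 ≤ N) (x : Fin k → Fin N) (c' : Multiset ℕ)
    (S : Finset (Fin N × Fin N × Fin N))
    (hS : ∀ p ∈ distinctTriplesFinset N, p ∉ S → ∀ y : Fin k → Fin N, config y = c' →
      ∏ m : Fin k, qFactor x y p m = 0) :
    |∑ y ∈ Finset.univ.filter (fun y : Fin k → Fin N => config y = c'), Qmat N k x y|
      ≤ 9 / (2 * (N : ℝ) ^ 3) * (S.card : ℝ) := by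
  have hN' : (3 : ℝ) ≤ N := by exact_mod_cast hN
  unfold Qmat
  rw [← Finset.mul_sum, Finset.sum_comm, abs_mul]
  have h0 : 0 ≤ ∑ p ∈ distinctTriplesFinset N,
      ∑ y ∈ Finset.univ.filter (fun y : Fin k → Fin N => config y = c'),
        ∏ m : Fin k, qFactor x y p m :=
    Finset.sum_nonneg fun p _ => Finset.sum_nonneg fun y _ =>
      Finset.prod_nonneg fun m _ => aux_q_nonneg x y p m
  rw [abs_of_nonneg h0]
  have hpos : 0 < (N : ℝ) * ((N : ℝ) - 1) * ((N : ℝ) - 2) := by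
    have : 0 < (N : ℝ) - 1 := by linarith
    have : 0 < (N : ℝ) - 2 := by linarith
    positivity
  have hco : |1 / ((N : ℝ) * ((N : ℝ) - 1) * ((N : ℝ) - 2))| ≤ 9 / (2 * (N : ℝ) ^ 3) := by
    rw [abs_of_pos (by positivity), div_le_div_iff₀ hpos (by positivity)]
    have : 0 ≤ (N : ℝ) * (((N : ℝ) - 3) * (7 * N - 6)) := by
      apply mul_nonneg (by linarith) (mul_nonneg (by linarith) (by linarith))
    nlinarith
  apply mul_le_mul hco _ h0 (by positivity)
  calc _ ≤ ∑ p ∈ distinctTriplesFinset N, (if p ∈ S then (1 : ℝ) else 0) := by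
        apply Finset.sum_le_sum
        intro p hp
        split_ifs with hpS
        · rw [← aux_sum_one x p]
          apply Finset.sum_le_sum_of_subset_of_nonneg (Finset.filter_subset _ _)
          intro y _ _
          exact Finset.prod_nonneg fun m _ => aux_q_nonneg x y p m
        · apply le_of_eq
          apply Finset.sum_eq_zero
          intro y hy
          exact hS p hp hpS y (Finset.mem_filter.mp hy).2
    _ ≤ ∑ p : Fin N × Fin N × Fin N, (if p ∈ S then (1 : ℝ) else 0) := by
        apply Finset.sum_le_sum_of_subset_of_nonneg (Finset.subset_univ _)
        intros; split_ifs <;> norm_num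
    _ = (S.card : ℝ) := by simp

lemma aux_child {N k : ℕ} {x y : Fin k → Fin N} {p : Fin N × Fin N × Fin N}
    (h : ∏ m : Fin k, qFactor x y p m ≠ 0) (hne : config x ≠ config y) :
    p.2.2 ∈ Finset.image x Finset.univ := by
  by_contra hp
  apply hne
  congr 1
  funext m
  refine ((aux_q_ne h m).1 ?_).symm
  intro hx
  exact hp (Finset.mem_image.mpr ⟨m, Finset.mem_univ m, hx⟩)

lemma aux_perm {N k : ℕ} {x y : Fin k → Fin N} {a κ : Fin N}
    (ha : a ∉ Finset.image x Finset.univ)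
    (h1 : ∀ m, x m ≠ κ → y m = x m) (h2 : ∀ m, x m = κ → y m = a) :
    config y = config x := by
  rw [← aux_config_comp x (Equiv.swap κ a)]
  congr 1
  funext m
  by_cases hx : x m = κ
  · rw [h2 m hx, hx, Equiv.swap_apply_left]
  · rw [h1 m hx, Equiv.swap_apply_of_ne_of_ne hx]
    intro h
    exact ha (Finset.mem_image.mpr ⟨m, Finset.mem_univ m, h⟩)

lemma aux_parent {N k : ℕ} {x y : Fin k → Fin N} {p : Fin N × Fin N × Fin N}
    (hp : p ∈ distinctTriplesFinset N)
    (h : ∏ m : Fin k, qFactor x y p m ≠ 0) (hne : config x ≠ config y)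
    (hle : (config y).card ≤ (config x).card) :
    p.1 ∈ Finset.image x Finset.univ ∨ p.2.1 ∈ Finset.image x Finset.univ := by
  by_contra! hcon
  obtain ⟨h1, h2⟩ := hcon
  have hq := aux_q_ne h
  have hκ := aux_child h hne
  simp only [distinctTriplesFinset, Finset.mem_filter, Finset.mem_univ, true_and] at hp
  by_cases hA : ∀ m, x m = p.2.2 → y m = p.1
  · exact hne (aux_perm h1 (fun m => (hq m).1) hA).symm
  by_cases hB : ∀ m, x m = p.2.2 → y m = p.2.1
  · exact hne (aux_perm h2 (fun m => (hq m).1) hB).symm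
  push Not at hA hB
  obtain ⟨m, hm, hm'⟩ := hA
  obtain ⟨n, hn, hn'⟩ := hB
  have hm2 := ((hq m).2 hm).resolve_left hm'
  have hn2 := ((hq n).2 hn).resolve_right hn'
  rw [aux_config_card, aux_config_card] at hle
  have hsub : insert p.1 (insert p.2.1 ((Finset.image x Finset.univ).erase p.2.2))
      ⊆ Finset.image y Finset.univ := by
    intro v hv
    simp only [Finset.mem_insert, Finset.mem_erase, Finset.mem_image, Finset.mem_univ,
      true_and] at hv ⊢
    rcases hv with rfl | rfl | ⟨hv, j, rfl⟩
    · exact ⟨n, hn2⟩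
    · exact ⟨m, hm2⟩
    · exact ⟨j, (hq j).1 hv⟩
  have hc := Finset.card_le_card hsub
  have e2 : p.2.1 ∉ (Finset.image x Finset.univ).erase p.2.2 :=
    fun hh => h2 (Finset.mem_of_mem_erase hh)
  have e1 : p.1 ∉ insert p.2.1 ((Finset.image x Finset.univ).erase p.2.2) := by
    intro hh
    rcases Finset.mem_insert.mp hh with hh | hh
    · exact hp.1 hh
    · exact h1 (Finset.mem_of_mem_erase hh)
  rw [Finset.card_insert_of_notMem e1, Finset.card_insert_of_notMem e2] at hc
  have := Finset.card_erase_add_one hκ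
  omega

lemma aux_small {k : ℕ} (x y : Fin k → Fin 2) : Qmat 2 k x y = 0 := by
  simp [Qmat]

/-- Orders of magnitude of the configuration-chain transition probabilities: for two distinct
configurations `c` and `c'` of sizes `l` and `l'`, the transition probability
`P_N(c, c') = Σ_{y : {y} = c'} Q(x, y)` (for any `x` with `{x} = c`) is `O(1/N)` if
`l' = l + 1`, and `O(1/N²)` if `l' ≤ l`. -/
theorem configChain_transition_bigO
    (k : ℕ) (hk : 1 ≤ k)
    (c c' : Multiset ℕ) (hcc' : c ≠ c')
    (hc : ∀ a ∈ c, 0 < a) (hcsum : c.sum = k)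
    (hc' : ∀ a ∈ c', 0 < a) (hc'sum : c'.sum = k) :
    (c'.card = c.card + 1 →
      ∃ C : ℝ, ∀ N : ℕ, k < N → ∀ x : Fin k → Fin N, config x = c →
        |∑ y ∈ Finset.univ.filter (fun y : Fin k → Fin N => config y = c'), Qmat N k x y|
          ≤ C / (N : ℝ)) ∧
    (c'.card ≤ c.card →
      ∃ C : ℝ, ∀ N : ℕ, k < N → ∀ x : Fin k → Fin N, config x = c →
        |∑ y ∈ Finset.univ.filter (fun y : Fin k → Fin N => config y = c'), Qmat N k x y|
          ≤ C / (N : ℝ) ^ 2) := by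
  have hI : ∀ N : ℕ, ∀ x : Fin k → Fin N,
      ((Finset.image x Finset.univ).card : ℝ) ≤ k := by
    intro N x
    have := Finset.card_image_le (s := Finset.univ) (f := x)
    rw [Finset.card_univ, Fintype.card_fin] at this
    exact_mod_cast this
  constructor
  · intro _
    refine ⟨9 / 2 * k, ?_⟩
    intro N hN x hx
    rcases Nat.lt_or_ge N 3 with hN3 | hN3
    · obtain rfl : N = 2 := by omega
      simp only [aux_small, Finset.sum_const_zero, abs_zero]
      positivity
    refine (aux_bound hN3 x c'
      (Finset.univ ×ˢ Finset.univ ×ˢ Finset.image x Finset.univ) ?_).trans ?_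
    · intro p hp hpS y hy
      by_contra h
      apply hpS
      have := aux_child h (by rw [hx, hy]; exact hcc')
      simp only [Finset.mem_product, Finset.mem_univ, true_and]
      exact this
    · have hN0 : (0 : ℝ) < N := by exact_mod_cast (by omega : 0 < N)
      simp only [Finset.card_product, Finset.card_univ, Fintype.card_fin, Nat.cast_mul]
      calc _ ≤ 9 / (2 * (N : ℝ) ^ 3) * (N * (N * (k : ℝ))) := by
            gcongr; exact_mod_cast hI N x
        _ = _ := by field_simp
  · intro hle
    refine ⟨9 * k ^ 2, ?_⟩
    intro N hN x hx
    rcases Nat.lt_or_ge N 3 with hN3 | hN3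
    · obtain rfl : N = 2 := by omega
      simp only [aux_small, Finset.sum_const_zero, abs_zero]
      positivity
    refine (aux_bound hN3 x c'
      ((Finset.image x Finset.univ ×ˢ Finset.univ ×ˢ Finset.image x Finset.univ) ∪
        (Finset.univ ×ˢ Finset.image x Finset.univ ×ˢ Finset.image x Finset.univ)) ?_).trans ?_
    · intro p hp hpS y hy
      by_contra h
      apply hpS
      have hne : config x ≠ config y := by rw [hx, hy]; exact hcc'
      have h1 := aux_child h hne
      have h2 := aux_parent hp h hne (by rw [hx, hy]; exact hle)
      rw [Finset.mem_union]
      simp only [Finset.mem_product, Finset.mem_univ, true_and]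
      exact h2.imp (fun a => ⟨a, h1⟩) (fun a => ⟨a, h1⟩)
    · have hN0 : (0 : ℝ) < N := by exact_mod_cast (by omega : 0 < N)
      have hu := Finset.card_union_le
        (Finset.image x Finset.univ ×ˢ (Finset.univ : Finset (Fin N)) ×ˢ
          Finset.image x Finset.univ)
        ((Finset.univ : Finset (Fin N)) ×ˢ Finset.image x Finset.univ ×ˢ
          Finset.image x Finset.univ)
      simp only [Finset.card_product, Finset.card_univ, Fintype.card_fin] at hu
      have hu' := (Nat.cast_le (α := ℝ)).mpr hu
      push_cast at hu'
      have hi := hI N x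
      calc _ ≤ 9 / (2 * (N : ℝ) ^ 3) * (k * (N * (k : ℝ)) + N * (k * k)) := by
            refine mul_le_mul_of_nonneg_left (hu'.trans ?_) (by positivity)
            gcongr
        _ = _ := by field_simp; ring
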